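/- arXiv:2603.27668 — 3 statements merged into one kernel-verified Lean document; each statement's English description precedes it below -/
import Mathlib

section
/- Let X_d be a split del Pezzo surface of degree d with 3 ≤ d ≤ 6 over a field k, and let α be a nef class on X_d. Then there exist a birational morphism ψ : X_d → X_{d−1} contracting a single (−1)-curve E to a del Pezzo surface X_{d−1} of degree d−1, an integral nef class β on X_{d−1}, and an integer b ≥ 0 such that α = −b·K_{X_d} + ψ^*β. Moreover b = min over all irreducible (−1)-curves L ⊂ X_d of α·L, and the data (β, ψ, b) are unique if β is ample. -/
/-!
# Statement 3

Decomposition of nef classes on split del Pezzo surfaces of degree `3 ≤ d ≤ 6`.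

A split del Pezzo surface of degree `d` over a field `k` is the blow-up of `ℙ²` in
`9 - d` rational points in general position; its Picard group is the lattice
`ℤ^{1 + (9-d)}` with basis `h, e₁, …, e_{9-d}` and the intersection pairing
`h² = 1`, `eᵢ² = −1`.  Its irreducible `(−1)`-curves ("lines") are exactly the classes `L`
with `L·L = −1` and `K·L = −1`, and these generate the effective cone, so a class `α` is
nef iff `α·L ≥ 0` for every line `L`.  Below we take `m + 1 = 9 - d` (so `3 ≤ d ≤ 6`
corresponds to `2 ≤ m ≤ 5`): the surface `X_d` has Picard lattice `PicBl (m+1)` and the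
target of a contraction of a single `(−1)`-curve has Picard lattice `PicBl m`.
-/

/-- Picard lattice of the blow-up of `ℙ²` in `n` rational points: `ℤ^{1+n}` with basis
`h, e₁, …, e_n`. -/
abbrev PicBl (n : ℕ) : Type := Fin (n + 1) → ℤ

/-- The intersection pairing on `PicBl n`. -/
def interB {n : ℕ} (x y : PicBl n) : ℤ :=
  x 0 * y 0 - ∑ i : Fin n, x i.succ * y i.succ

/-- The canonical class `K = −3h + e₁ + ⋯ + e_n`. -/
def KB (n : ℕ) : PicBl n := fun j => if j = 0 then -3 else 1

/-- A line: the class of an irreducible `(−1)`-curve; on a split del Pezzo surface these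
are exactly the classes `L` with `L·L = −1` and `K·L = −1`. -/
def IsLineB {n : ℕ} (L : PicBl n) : Prop := interB L L = -1 ∧ interB (KB n) L = -1

/-- A class is nef iff it pairs non-negatively with every line (the lines generate the
effective cone). -/
def NefB {n : ℕ} (α : PicBl n) : Prop := ∀ L, IsLineB L → 0 ≤ interB α L

/-- A class is ample iff it pairs positively with every line. -/
def AmpleB {n : ℕ} (α : PicBl n) : Prop := ∀ L, IsLineB L → 0 < interB α L

/-- `φ` is the pullback map on Picard lattices of a birational morphism `ψ : X → X'`
contracting the single `(−1)`-curve `E`: an isometric embedding whose image is orthogonal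
to `E` and which sends the canonical class of `X'` to `K_X − E`
(so that `K_X = ψ^*K_{X'} + E`). -/
def IsContractionPullback {n : ℕ} (E : PicBl (n + 1))
    (φ : PicBl n →ₗ[ℤ] PicBl (n + 1)) : Prop :=
  (∀ x y, interB (φ x) (φ y) = interB x y) ∧
  (∀ x, interB E (φ x) = 0) ∧
  φ (KB n) = KB (n + 1) - E

section Pairing

variable {n : ℕ}

lemma interB_comm (x y : PicBl n) : interB x y = interB y x := by
  simp only [interB, mul_comm]

lemma interB_add_left (x y z : PicBl n) : interB (x + y) z = interB x z + interB y z := by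
  simp only [interB, Pi.add_apply, add_mul, Finset.sum_add_distrib]
  ring

lemma interB_smul_left (c : ℤ) (x z : PicBl n) : interB (c • x) z = c * interB x z := by
  simp only [interB, Pi.smul_apply, smul_eq_mul, mul_assoc, mul_sub, Finset.mul_sum]

lemma interB_add_right (x y z : PicBl n) : interB x (y + z) = interB x y + interB x z := by
  rw [interB_comm, interB_add_left, interB_comm y, interB_comm z]

lemma interB_smul_right (c : ℤ) (x z : PicBl n) : interB x (c • z) = c * interB x z := by
  rw [interB_comm, interB_smul_left, interB_comm]

lemma interB_neg_left (x z : PicBl n) : interB (-x) z = -interB x z := by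
  simpa using interB_smul_left (-1) x z

lemma interB_neg_right (x z : PicBl n) : interB x (-z) = -interB x z := by
  simpa using interB_smul_right (-1) x z

lemma interB_sub_left (x y z : PicBl n) : interB (x - y) z = interB x z - interB y z := by
  rw [sub_eq_add_neg, interB_add_left, interB_neg_left, sub_eq_add_neg]

lemma interB_sub_right (x y z : PicBl n) : interB x (y - z) = interB x y - interB x z := by
  rw [sub_eq_add_neg, interB_add_right, interB_neg_right, sub_eq_add_neg]

lemma interB_self (x : PicBl n) : interB x x = x 0 ^ 2 - ∑ i : Fin n, x i.succ ^ 2 := by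
  simp only [interB, sq]

lemma interB_KB (x : PicBl n) : interB (KB n) x = -3 * x 0 - ∑ i : Fin n, x i.succ := by
  simp [interB, KB]

lemma interB_KB_KB : interB (KB n) (KB n) = 9 - n := by
  simp [interB, KB]

lemma sum_sq_le (x : PicBl n) :
    (∑ i : Fin n, x i.succ) ^ 2 ≤ n * ∑ i : Fin n, x i.succ ^ 2 := by
  simpa using sq_sum_le_card_mul_sum_sq (s := Finset.univ) (f := fun i : Fin n => x i.succ)

/-- The Hodge index inequality for the canonical class. -/
lemma hodge_index (hn : 0 < n) (h9 : n ≤ 9) (x : PicBl n) :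
    (9 - n : ℤ) * interB x x ≤ interB (KB n) x ^ 2 := by
  have h := sum_sq_le x
  rw [interB_self, interB_KB]
  set s := ∑ i : Fin n, x i.succ
  set q := ∑ i : Fin n, x i.succ ^ 2
  have hn' : (0 : ℤ) < n := by exact_mod_cast hn
  have h9' : (n : ℤ) ≤ 9 := by exact_mod_cast h9
  have key : 0 ≤ (n : ℤ) * ((-3 * x 0 - s) ^ 2 - (9 - n) * (x 0 ^ 2 - q)) := by
    nlinarith [mul_le_mul_of_nonneg_left h (sub_nonneg.mpr h9'), sq_nonneg (n * x 0 + 3 * s)]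
  have := nonneg_of_mul_nonneg_right key hn'
  linarith

/-- The lattice `K^⊥` is negative definite. -/
lemma eq_zero_of_KB_orthogonal (hn : n < 9) {x : PicBl n} (hK : interB (KB n) x = 0)
    (hx : 0 ≤ interB x x) : x = 0 := by
  have h := sum_sq_le x
  rw [interB_KB] at hK
  rw [interB_self] at hx
  have hs : ∑ i : Fin n, x i.succ = -3 * x 0 := by linarith
  rw [hs] at h
  have hn' : (n : ℤ) < 9 := by exact_mod_cast hn
  have h0 : x 0 = 0 := by
    by_contra hne
    have : 0 < x 0 ^ 2 := by positivity
    nlinarith [mul_le_mul_of_nonneg_left hx (Int.natCast_nonneg n)]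
  have hq : ∑ i : Fin n, x i.succ ^ 2 = 0 :=
    le_antisymm (by simpa [h0] using hx) (Finset.sum_nonneg fun _ _ => sq_nonneg _)
  rw [Finset.sum_eq_zero_iff_of_nonneg fun _ _ => sq_nonneg _] at hq
  funext j
  refine Fin.cases h0 (fun i => ?_) j
  simpa using hq i (Finset.mem_univ i)

/-- The Riemann–Roch parity of the intersection pairing. -/
lemma even_interB_self_add_KB (x : PicBl n) : Even (interB x x + interB (KB n) x) := by
  have h : interB x x + interB (KB n) x
      = (x 0 * (x 0 + 1) - 2 * (2 * x 0)) - ∑ i : Fin n, x i.succ * (x i.succ + 1) := by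
    simp only [interB_self, interB_KB, mul_add, mul_one, Finset.sum_add_distrib, sq]
    ring
  rw [h]
  exact ((Int.even_mul_succ_self _).sub (even_two_mul _)).sub
    (Finset.even_sum _ fun _ _ => Int.even_mul_succ_self _)

/-- The class `a h + c ∑_{i ∈ T} eᵢ`. -/
def uniformClass (a c : ℤ) (T : Finset (Fin n)) : PicBl n :=
  Fin.cons a fun i => if i ∈ T then c else 0

lemma interB_uniformClass (x : PicBl n) (a c : ℤ) (T : Finset (Fin n)) :
    interB x (uniformClass a c T) = a * x 0 - c * ∑ i ∈ T, x i.succ := by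
  simp [interB, uniformClass, Finset.mul_sum, mul_comm]

lemma interB_uniformClass_self (a c : ℤ) (T : Finset (Fin n)) :
    interB (uniformClass a c T) (uniformClass a c T) = a ^ 2 - c ^ 2 * T.card := by
  rw [interB_uniformClass]
  simp +contextual [uniformClass, Finset.sum_ite_mem]
  ring

lemma interB_KB_uniformClass (a c : ℤ) (T : Finset (Fin n)) :
    interB (KB n) (uniformClass a c T) = -3 * a - c * T.card := by
  rw [interB_uniformClass]
  simp [KB]
  ring

lemma isLineB_uniformClass_zero (i : Fin n) : IsLineB (uniformClass 0 1 {i}) := by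
  simp [IsLineB, interB_uniformClass_self, interB_KB_uniformClass]

lemma isLineB_uniformClass_one {T : Finset (Fin n)} (hT : T.card = 2) :
    IsLineB (uniformClass 1 (-1) T) := by
  simp [IsLineB, interB_uniformClass_self, interB_KB_uniformClass, hT]

lemma eq_zero_or_eq_neg_one {x : PicBl n}
    (h : ∑ i : Fin n, x i.succ ^ 2 + ∑ i : Fin n, x i.succ = 0) (i : Fin n) :
    x i.succ = 0 ∨ x i.succ = -1 := by
  have hnn : ∀ j ∈ Finset.univ, 0 ≤ x (Fin.succ j) ^ 2 + x j.succ := fun j _ => by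
    rcases le_or_gt 0 (x j.succ) with h | h <;> nlinarith
  rw [← Finset.sum_add_distrib, Finset.sum_eq_zero_iff_of_nonneg hnn] at h
  have h' : x i.succ * (x i.succ + 1) = 0 := by linear_combination h i (Finset.mem_univ i)
  rcases mul_eq_zero.mp h' with h' | h'
  · exact Or.inl h'
  · exact Or.inr (by linarith)

/-- A class whose exceptional coefficients are all `0` or `-1` is `a h - ∑_{i ∈ S} eᵢ`. -/
lemma exists_eq_uniformClass {x : PicBl n}
    (h : ∑ i : Fin n, x i.succ ^ 2 + ∑ i : Fin n, x i.succ = 0) :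
    ∃ S : Finset (Fin n), x = uniformClass (x 0) (-1) S := by
  refine ⟨Finset.univ.filter fun i => x i.succ = -1, ?_⟩
  funext j
  refine Fin.cases rfl (fun i => ?_) j
  rcases eq_zero_or_eq_neg_one h i with h | h <;> simp [uniformClass, h]

lemma sum_uniformClass (a c : ℤ) (S T : Finset (Fin n)) :
    ∑ i ∈ T, uniformClass a c S i.succ = c * (T ∩ S).card := by
  simp [uniformClass, Finset.sum_ite_mem, mul_comm]

end Pairing

section Lines

variable {n : ℕ}

/-- On a surface of degree at least `3`, distinct lines are disjoint or meet once. -/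
lemma IsLineB.interB_eq_zero_or_one (hn : 0 < n) (hn' : n ≤ 6) {L E : PicBl n}
    (hL : IsLineB L) (hE : IsLineB E) (hne : L ≠ E) : interB E L = 0 ∨ interB E L = 1 := by
  obtain ⟨hL1, hL2⟩ := hL
  obtain ⟨hE1, hE2⟩ := hE
  have hle : interB E L ≤ 1 := by
    have h := hodge_index hn (by omega) (L + E)
    simp only [interB_add_left, interB_add_right, hL1, hL2, hE1, hE2, interB_comm L E] at h
    have hn6 : (n : ℤ) ≤ 6 := by exact_mod_cast hn'
    by_contra hlt
    nlinarith
  have hge : 0 ≤ interB E L := by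
    by_contra hlt
    refine hne (sub_eq_zero.mp (eq_zero_of_KB_orthogonal (by omega) ?_ ?_))
    · rw [interB_sub_right, hL2, hE2, sub_self]
    · simp only [interB_sub_left, interB_sub_right, hL1, hE1, interB_comm L E]
      omega
  omega

lemma IsLineB.degree_mem (hn' : n ≤ 6) {L : PicBl n} (hL : IsLineB L) :
    L 0 = 0 ∨ L 0 = 1 ∨ L 0 = 2 := by
  obtain ⟨h1, h2⟩ := hL
  have h := sum_sq_le L
  rw [interB_self] at h1
  rw [interB_KB] at h2
  have hs : ∑ i : Fin n, L i.succ = 1 - 3 * L 0 := by linarith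
  have hq : ∑ i : Fin n, L i.succ ^ 2 = L 0 ^ 2 + 1 := by linarith
  rw [hs, hq] at h
  have hn6 : (n : ℤ) ≤ 6 := by exact_mod_cast hn'
  have hb : (1 - 3 * L 0) ^ 2 ≤ 6 * (L 0 ^ 2 + 1) :=
    h.trans (mul_le_mul_of_nonneg_right hn6 (by positivity))
  have h0 : 0 ≤ L 0 := by nlinarith
  have h2 : L 0 ≤ 2 := by nlinarith
  omega

lemma IsLineB.eq_exceptional {L : PicBl n} (hL : IsLineB L) (h0 : L 0 = 0) :
    ∃ i : Fin n, L = uniformClass 0 1 {i} := by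
  obtain ⟨h1, h2⟩ := hL
  have hneg : ∑ i : Fin n, (-L) i.succ ^ 2 + ∑ i : Fin n, (-L) i.succ = 0 := by
    rw [interB_self] at h1
    rw [interB_KB] at h2
    simp only [Pi.neg_apply, neg_sq, Finset.sum_neg_distrib]
    rw [h0] at h1 h2
    linarith
  obtain ⟨S, hS⟩ := exists_eq_uniformClass hneg
  have hL : L = uniformClass 0 1 S := by
    funext j
    have := congrFun hS j
    refine Fin.cases (fun _ => by simpa [uniformClass] using h0) (fun i h => ?_) j this
    simp only [Pi.neg_apply, uniformClass, Fin.cons_succ] at h ⊢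
    split_ifs at h ⊢ <;> linarith
  have hcard : S.card = 1 := by
    rw [hL, interB_KB_uniformClass] at h2
    omega
  obtain ⟨i, rfl⟩ := Finset.card_eq_one.mp hcard
  exact ⟨i, hL⟩

/-- A line of positive degree meets some simple Cremona root negatively. -/
lemma IsLineB.exists_root (hn : 3 ≤ n) (hn' : n ≤ 6) {L : PicBl n} (hL : IsLineB L)
    (h0 : L 0 ≠ 0) :
    ∃ T : Finset (Fin n), T.card = 3 ∧ interB L (uniformClass 1 (-1) T) = -1 := by
  have hdeg := (hL.degree_mem hn').resolve_left h0
  obtain ⟨h1, h2⟩ := hL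
  have hsum : ∑ i : Fin n, L i.succ ^ 2 + ∑ i : Fin n, L i.succ = 0 := by
    rw [interB_self] at h1
    rw [interB_KB] at h2
    rcases hdeg with h | h <;> rw [h] at h1 h2 <;> linarith
  obtain ⟨S, hS⟩ := exists_eq_uniformClass hsum
  have hcard : (S.card : ℤ) = 3 * L 0 - 1 := by
    rw [hS, interB_KB_uniformClass] at h2
    linarith
  have hint : ∀ T : Finset (Fin n),
      interB L (uniformClass 1 (-1) T) = L 0 - (T ∩ S).card := fun T => by
    rw [interB_uniformClass]
    nth_rw 2 [hS]
    rw [sum_uniformClass]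
    ring
  rcases hdeg with h | h
  · obtain ⟨T, hST, hT⟩ := Finset.exists_superset_card_eq (s := S) (n := 3) (by omega)
      (by simpa using hn)
    refine ⟨T, hT, ?_⟩
    rw [hint, Finset.inter_eq_right.mpr hST]
    omega
  · obtain ⟨T, hTS, hT⟩ := Finset.exists_subset_card_eq (s := S) (n := 3) (by omega)
    refine ⟨T, hT, ?_⟩
    rw [hint, Finset.inter_eq_left.mpr hTS]
    omega

lemma IsLineB.sub {D M : PicBl n} (hD : interB D D = 0) (hKD : interB (KB n) D = -2)
    (hM : IsLineB M) (hDM : interB D M = 0) : IsLineB (D - M) := by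
  obtain ⟨h1, h2⟩ := hM
  constructor
  · simp only [interB_sub_left, interB_sub_right, hD, hDM, h1, interB_comm M D]
    norm_num
  · rw [interB_sub_right, hKD, h2]
    norm_num

/-- A conic class on a surface of degree between `4` and `7` has a component which is a line. -/
lemma exists_isLineB_conic (hn : 2 ≤ n) (hn' : n ≤ 5) {D : PicBl n}
    (hD : interB D D = 0) (hKD : interB (KB n) D = -2) :
    ∃ M, IsLineB M ∧ interB D M = 0 := by
  have h1 := hD
  have h2 := hKD
  have h := sum_sq_le D
  rw [interB_self] at h1
  rw [interB_KB] at h2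
  have hs : ∑ i : Fin n, D i.succ = 2 - 3 * D 0 := by linarith
  have hq : ∑ i : Fin n, D i.succ ^ 2 = D 0 ^ 2 := by linarith
  rw [hs, hq] at h
  have hn5 : (n : ℤ) ≤ 5 := by exact_mod_cast hn'
  have hb : (2 - 3 * D 0) ^ 2 ≤ 5 * D 0 ^ 2 :=
    h.trans (mul_le_mul_of_nonneg_right hn5 (by positivity))
  have hlo : 1 ≤ D 0 := by nlinarith
  have hhi : D 0 ≤ 2 := by nlinarith
  have hdeg : D 0 = 1 ∨ D 0 = 2 := by omega
  have hsum : ∑ i : Fin n, D i.succ ^ 2 + ∑ i : Fin n, D i.succ = 0 := by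
    rw [hs, hq]
    rcases hdeg with h | h <;> rw [h] <;> norm_num
  obtain ⟨S, hS⟩ := exists_eq_uniformClass hsum
  have hcard : (S.card : ℤ) = 3 * D 0 - 2 := by
    rw [hS, interB_KB_uniformClass] at hKD
    linarith
  rcases hdeg with h | h
  · obtain ⟨j, hj⟩ : ∃ j, j ∉ S := by
      by_contra! hall
      have hu : S = Finset.univ := Finset.eq_univ_iff_forall.mpr hall
      rw [hu, Finset.card_univ, Fintype.card_fin] at hcard
      omega
    refine ⟨_, isLineB_uniformClass_zero j, ?_⟩
    rw [interB_uniformClass, hS, sum_uniformClass]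
    simp [hj]
  · obtain ⟨T, hTS, hT⟩ := Finset.exists_subset_card_eq (s := S) (n := 2) (by omega)
    refine ⟨_, isLineB_uniformClass_one hT, ?_⟩
    rw [interB_uniformClass]
    nth_rw 2 [hS]
    rw [sum_uniformClass, Finset.inter_eq_left.mpr hTS, hT, h]
    norm_num

lemma AmpleB.interB_conic_pos (hn : 2 ≤ n) (hn' : n ≤ 5) {β D : PicBl n} (hβ : AmpleB β)
    (hD : interB D D = 0) (hKD : interB (KB n) D = -2) : 0 < interB β D := by
  obtain ⟨M, hM, hDM⟩ := exists_isLineB_conic hn hn' hD hKD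
  have h1 := hβ M hM
  have h2 := hβ _ (IsLineB.sub hD hKD hM hDM)
  rw [interB_sub_right] at h2
  linarith

end Lines

section Reflection

variable {n : ℕ}

/-- The reflection in a root `r`, a class with `r·r = -2`. -/
def rootReflection (r : PicBl n) : PicBl n →ₗ[ℤ] PicBl n where
  toFun x := x + interB x r • r
  map_add' x y := by rw [interB_add_left, add_smul]; abel
  map_smul' c x := by rw [interB_smul_left, mul_smul, smul_add, RingHom.id_apply]

lemma rootReflection_apply (r x : PicBl n) : rootReflection r x = x + interB x r • r := rfl

lemma interB_rootReflection {r : PicBl n} (hr : interB r r = -2) (x y : PicBl n) :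
    interB (rootReflection r x) (rootReflection r y) = interB x y := by
  simp only [rootReflection_apply, interB_add_left, interB_add_right, interB_smul_left,
    interB_smul_right, hr, interB_comm r y]
  ring

lemma rootReflection_rootReflection {r : PicBl n} (hr : interB r r = -2) (x : PicBl n) :
    rootReflection r (rootReflection r x) = x := by
  simp only [rootReflection_apply, interB_add_left, interB_smul_left, hr]
  module

lemma rootReflection_KB {r : PicBl n} (hK : interB (KB n) r = 0) :
    rootReflection r (KB n) = KB n := by
  rw [rootReflection_apply, hK, zero_smul, add_zero]

lemma IsLineB.rootReflection {r L : PicBl n} (hr : interB r r = -2)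
    (hK : interB (KB n) r = 0) (hL : IsLineB L) : IsLineB (rootReflection r L) := by
  refine ⟨(interB_rootReflection hr _ _).trans hL.1, ?_⟩
  rw [← rootReflection_KB hK, interB_rootReflection hr, hL.2]

end Reflection

section Contraction

variable {n : ℕ}

/-- `φ` is the pullback of a contraction of `E` whose image is all of `E^⊥`. -/
def IsFullContractionPullback (E : PicBl (n + 1)) (φ : PicBl n →ₗ[ℤ] PicBl (n + 1)) : Prop :=
  IsContractionPullback E φ ∧ ∀ x, interB E x = 0 → ∃ y, φ y = x

/-- Pullback along the contraction of the exceptional curve `eᵢ`. -/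
def insertExceptional (i : Fin (n + 1)) : PicBl n →ₗ[ℤ] PicBl (n + 1) where
  toFun x := i.succ.insertNth (α := fun _ => ℤ) 0 x
  map_add' x y := by
    funext j
    refine Fin.succAboveCases i.succ ?_ (fun j => ?_) j <;> simp
  map_smul' c x := by
    funext j
    refine Fin.succAboveCases i.succ ?_ (fun j => ?_) j <;> simp

lemma insertExceptional_zero (i : Fin (n + 1)) (x : PicBl n) :
    insertExceptional i x 0 = x 0 := by
  have := Fin.insertNth_apply_succAbove (α := fun _ => ℤ) i.succ 0 x 0
  rwa [Fin.succ_succAbove_zero] at this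

lemma insertExceptional_succ_self (i : Fin (n + 1)) (x : PicBl n) :
    insertExceptional i x i.succ = 0 :=
  Fin.insertNth_apply_same (α := fun _ => ℤ) i.succ 0 x

lemma insertExceptional_succ_succAbove (i : Fin (n + 1)) (x : PicBl n) (j : Fin n) :
    insertExceptional i x (i.succAbove j).succ = x j.succ := by
  have := Fin.insertNth_apply_succAbove (α := fun _ => ℤ) i.succ 0 x j.succ
  rwa [Fin.succ_succAbove_succ] at this

lemma isFullContractionPullback_insertExceptional (i : Fin (n + 1)) :
    IsFullContractionPullback (uniformClass 0 1 {i}) (insertExceptional i) := by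
  refine ⟨⟨fun x y => ?_, fun x => ?_, ?_⟩, fun x hx => ?_⟩
  · simp only [interB, Fin.sum_univ_succAbove _ i, insertExceptional_zero,
      insertExceptional_succ_self, insertExceptional_succ_succAbove]
    ring
  · rw [interB_comm, interB_uniformClass]
    simp [insertExceptional_succ_self]
  · funext j
    refine Fin.cases ?_ (fun j => Fin.succAboveCases i ?_ (fun j => ?_) j) j
    · simp [insertExceptional_zero, KB, uniformClass]
    · simp [insertExceptional_succ_self, KB, uniformClass]
    · simp [insertExceptional_succ_succAbove, KB, uniformClass]
  · rw [interB_comm, interB_uniformClass] at hx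
    have hx : x i.succ = 0 := by simpa using hx
    refine ⟨i.succ.removeNth x, ?_⟩
    change i.succ.insertNth (α := fun _ => ℤ) 0 (i.succ.removeNth x) = x
    rw [← hx, Fin.insertNth_self_removeNth]

lemma IsFullContractionPullback.rootReflection {E r : PicBl (n + 1)}
    {φ : PicBl n →ₗ[ℤ] PicBl (n + 1)} (hφ : IsFullContractionPullback E φ)
    (hr : interB r r = -2) (hK : interB (KB (n + 1)) r = 0) :
    IsFullContractionPullback (rootReflection r E) (rootReflection r ∘ₗ φ) := by
  obtain ⟨⟨h1, h2, h3⟩, h4⟩ := hφ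
  refine ⟨⟨fun x y => ?_, fun x => ?_, ?_⟩, fun x hx => ?_⟩
  · rw [LinearMap.comp_apply, LinearMap.comp_apply, interB_rootReflection hr, h1]
  · rw [LinearMap.comp_apply, interB_rootReflection hr, h2]
  · rw [LinearMap.comp_apply, h3, map_sub, rootReflection_KB hK]
  · obtain ⟨y, hy⟩ := h4 (_root_.rootReflection r x) (by
      rw [← interB_rootReflection hr, rootReflection_rootReflection hr, hx])
    exact ⟨y, by rw [LinearMap.comp_apply, hy, rootReflection_rootReflection hr]⟩

/-- Every line on a del Pezzo surface of degree between `3` and `6` can be contracted. -/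
lemma IsLineB.exists_contraction (hn : 2 ≤ n) (hn' : n ≤ 5) {E : PicBl (n + 1)}
    (hE : IsLineB E) : ∃ φ, IsFullContractionPullback E φ := by
  have hdeg : ∃ k : ℕ, E 0 = k := by
    rcases hE.degree_mem (by omega) with h | h | h
    exacts [⟨0, h⟩, ⟨1, h⟩, ⟨2, h⟩]
  obtain ⟨k, hk⟩ := hdeg
  induction k generalizing E with
  | zero =>
    obtain ⟨i, rfl⟩ := hE.eq_exceptional hk
    exact ⟨_, isFullContractionPullback_insertExceptional i⟩
  | succ k ih =>
    obtain ⟨T, hT, hET⟩ := hE.exists_root (by omega) (by omega) (by rw [hk]; positivity)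
    have hr : interB (uniformClass 1 (-1) T) (uniformClass 1 (-1) T) = -2 := by
      rw [interB_uniformClass_self, hT]
      norm_num
    have hK : interB (KB (n + 1)) (uniformClass 1 (-1) T) = 0 := by
      rw [interB_KB_uniformClass, hT]
      norm_num
    obtain ⟨φ, hφ⟩ := ih (hE.rootReflection hr hK) (by
      rw [rootReflection_apply, hET]
      simp [uniformClass, hk])
    have := hφ.rootReflection hr hK
    rw [rootReflection_rootReflection hr] at this
    exact ⟨_, this⟩

/-- The intersection pairing is unimodular. -/
lemma exists_interB_eq (f : PicBl n →ₗ[ℤ] ℤ) : ∃ z, ∀ y, interB y z = f y := by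
  refine ⟨Fin.cons (f (Pi.single 0 1)) fun i => -f (Pi.single i.succ 1), fun y => ?_⟩
  conv_rhs => rw [← LinearMap.sum_single_apply (fun _ => ℤ) y, map_sum]
  have hs : ∀ j, f (Pi.single j (y j)) = y j * f (Pi.single j 1) := fun j => by
    rw [← smul_eq_mul, ← map_smul, ← Pi.single_smul, smul_eq_mul, mul_one]
  simp [interB, Fin.sum_univ_succ, hs]

/-- The pullback of an ample class is positive on every line other than the contracted one. -/
lemma IsContractionPullback.interB_pos (hn : 2 ≤ n) (hn' : n ≤ 5) {E L : PicBl (n + 1)}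
    {φ : PicBl n →ₗ[ℤ] PicBl (n + 1)} (hφ : IsContractionPullback E φ) (hE : IsLineB E)
    (hL : IsLineB L) (hne : L ≠ E) {β : PicBl n} (hβ : AmpleB β) : 0 < interB (φ β) L := by
  obtain ⟨h1, h2, h3⟩ := hφ
  obtain ⟨z, hz⟩ := exists_interB_eq (n := n)
    { toFun := fun y => interB (φ y) L
      map_add' := fun x y => by rw [map_add, interB_add_left]
      map_smul' := fun c x => by
        rw [map_smul, interB_smul_left, RingHom.id_apply, smul_eq_mul] }
  replace hz : ∀ y, interB y z = interB (φ y) L := hz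
  have hKz : interB (KB n) z = -1 - interB E L := by
    rw [hz, h3, interB_sub_left, hL.2]
  have hz2 : -1 + interB E L ^ 2 ≤ interB z z := by
    set w := L - φ z + interB E L • E with hw
    have hφw : ∀ y, interB (φ y) w = 0 := fun y => by
      rw [hw, interB_add_right, interB_sub_right, interB_smul_right, h1, hz,
        interB_comm _ E, h2]
      ring
    have hEw : interB E w = 0 := by
      rw [hw, interB_add_right, interB_sub_right, interB_smul_right, h2, hE.1]
      ring
    have hKw : interB (KB (n + 1)) w = 0 := by
      rw [← sub_add_cancel (KB (n + 1)) E, ← h3, interB_add_left, hφw, hEw, add_zero]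
    have hww : interB w w = -1 - interB z z + interB E L ^ 2 := by
      nth_rw 1 [hw]
      rw [interB_add_left, interB_sub_left, interB_smul_left, hφw, hEw, hw, interB_add_right,
        interB_sub_right, interB_smul_right, hL.1, interB_comm L, ← hz, interB_comm L]
      ring
    have hle : interB w w ≤ 0 := by
      by_contra hlt
      have hw0 := eq_zero_of_KB_orthogonal (by omega) hKw (not_le.mp hlt).le
      rw [hw0] at hlt
      exact hlt (by simp [interB])
    linarith
  have hhodge := hodge_index (by omega) (by omega) z
  have hpar := even_interB_self_add_KB z
  have hn5 : (n : ℤ) ≤ 5 := by exact_mod_cast hn'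
  rw [← hz]
  rcases hL.interB_eq_zero_or_one (by omega) (by omega) hE hne with h | h <;>
    rw [h] at hKz hz2 <;> rw [hKz] at hhodge hpar
  · have hlt : interB z z < 1 := by nlinarith
    refine hβ z ⟨?_, hKz⟩
    rw [Int.even_iff] at hpar
    omega
  · have hlt : interB z z < 2 := by nlinarith
    refine hβ.interB_conic_pos hn hn' ?_ hKz
    rw [Int.even_iff] at hpar
    omega

lemma interB_decomposition {α δ L : PicBl n} {b : ℤ} (hα : α = b • (-KB n) + δ)
    (hL : IsLineB L) : interB α L = b + interB δ L := by
  rw [hα, interB_add_left, interB_smul_left, interB_neg_left, hL.2]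
  ring

/-- In a decomposition `α = -b K + ψ^*β` with `β` ample, the contracted line is the unique line
of minimal `α`-degree, and that degree is `b`. -/
lemma IsContractionPullback.lt_interB (hn : 2 ≤ n) (hn' : n ≤ 5) {α E L : PicBl (n + 1)}
    {φ : PicBl n →ₗ[ℤ] PicBl (n + 1)} (hφ : IsContractionPullback E φ) (hE : IsLineB E)
    {β : PicBl n} (hβ : AmpleB β) {b : ℤ} (hα : α = b • (-KB (n + 1)) + φ β)
    (hL : IsLineB L) (hne : L ≠ E) : b < interB α L := by
  rw [interB_decomposition hα hL]
  linarith [hφ.interB_pos hn hn' hE hL hne hβ]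

lemma IsContractionPullback.interB_eq {α E : PicBl (n + 1)}
    {φ : PicBl n →ₗ[ℤ] PicBl (n + 1)} (hφ : IsContractionPullback E φ) (hE : IsLineB E)
    {β : PicBl n} {b : ℤ} (hα : α = b • (-KB (n + 1)) + φ β) : interB α E = b := by
  rw [interB_decomposition hα hE, interB_comm, hφ.2.1, add_zero]

lemma IsContractionPullback.isLineB_map {E : PicBl (n + 1)} {L : PicBl n}
    {φ : PicBl n →ₗ[ℤ] PicBl (n + 1)} (hφ : IsContractionPullback E φ) (hL : IsLineB L) :
    IsLineB (φ L) := by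
  obtain ⟨h1, h2, h3⟩ := hφ
  refine ⟨(h1 _ _).trans hL.1, ?_⟩
  rw [← sub_add_cancel (KB (n + 1)) E, ← h3, interB_add_left, h1, h2, hL.2, add_zero]

/-- A nef class attains its minimal degree on some line. -/
lemma NefB.exists_min {α : PicBl (n + 1)} (hα : NefB α) :
    ∃ (E : PicBl (n + 1)) (b : ℕ), IsLineB E ∧ interB α E = b ∧
      ∀ L, IsLineB L → (b : ℤ) ≤ interB α L := by
  classical
  have hex : ∃ b : ℕ, ∃ E, IsLineB E ∧ interB α E = b :=
    ⟨_, _, isLineB_uniformClass_zero 0,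
      (Int.toNat_of_nonneg (hα _ (isLineB_uniformClass_zero 0))).symm⟩
  obtain ⟨E, hE, hEb⟩ := Nat.find_spec hex
  refine ⟨E, _, hE, hEb, fun L hL => ?_⟩
  have := Nat.find_min' hex ⟨L, hL, (Int.toNat_of_nonneg (hα L hL)).symm⟩
  have := hα L hL
  omega

end Contraction

/-- Let `X_d` (`3 ≤ d ≤ 6`, i.e. `2 ≤ m ≤ 5` with `m + 1 = 9 - d`
blown-up points) be a split del Pezzo surface and `α` a nef class on `X_d`.  Then there
exist a contraction `ψ : X_d → X_{d-1}` of a single `(−1)`-curve `E` (encoded by its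
pullback `φ` on Picard lattices), an integral nef class `β` on the target, and an integer
`b ≥ 0`, with `α = −b·K_{X_d} + ψ^*β`.  Moreover `b = min_{L line} α·L`, and the data
`(β, ψ, b)` is unique if `β` is ample. -/
theorem statement3 (m : ℕ) (hm : 2 ≤ m) (hm' : m ≤ 5)
    (α : PicBl (m + 1)) (hα : NefB α) :
    ∃ (E : PicBl (m + 1)) (φ : PicBl m →ₗ[ℤ] PicBl (m + 1)) (β : PicBl m) (b : ℕ),
      IsLineB E ∧ IsContractionPullback E φ ∧ NefB β ∧
      α = (b : ℤ) • (-KB (m + 1)) + φ β ∧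
      (∀ L, IsLineB L → (b : ℤ) ≤ interB α L) ∧
      (∃ L, IsLineB L ∧ interB α L = b) ∧
      (AmpleB β →
        ∀ (E' : PicBl (m + 1)) (φ' : PicBl m →ₗ[ℤ] PicBl (m + 1)) (β' : PicBl m) (b' : ℕ),
          IsLineB E' → IsContractionPullback E' φ' → NefB β' → AmpleB β' →
          α = (b' : ℤ) • (-KB (m + 1)) + φ' β' →
          b' = b ∧ E' = E ∧ φ' β' = φ β) := by
  obtain ⟨E, b, hE, hEb, hmin⟩ := hα.exists_min
  obtain ⟨φ, hφ, hsurj⟩ := hE.exists_contraction hm hm'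
  obtain ⟨β, hβ⟩ := hsurj (α - (b : ℤ) • (-KB (m + 1))) (by
    rw [interB_sub_right, interB_smul_right, interB_neg_right, interB_comm E,
      interB_comm E, hE.2, hEb]
    ring)
  have hdec : α = (b : ℤ) • (-KB (m + 1)) + φ β := by rw [hβ]; abel
  refine ⟨E, φ, β, b, hE, hφ, fun L hL => ?_, hdec, hmin, ⟨E, hE, hEb⟩, ?_⟩
  · have hφL := hφ.isLineB_map hL
    have := hmin _ hφL
    rw [interB_decomposition hdec hφL, hφ.1] at this
    linarith
  · intro hβa E' φ' β' b' hE' hφ' _ hβ'a hdec'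
    have hE'b := hφ'.interB_eq hE' hdec'
    have hEE : E' = E := by
      by_contra hne
      have h1 := hφ.lt_interB hm hm' hE hβa hdec hE' hne
      have h2 := hφ'.lt_interB hm hm' hE' hβ'a hdec' hE (Ne.symm hne)
      linarith
    have hbb : b' = b := by
      rw [hEE, hEb] at hE'b
      exact_mod_cast hE'b.symm
    refine ⟨hbb, hEE, ?_⟩
    rw [hbb, hdec] at hdec'
    exact (add_left_cancel hdec').symm
end

section
/- Let α be a nef class on a split del Pezzo surface X_5 of degree 5 lying in a cone 𝒯_{(E_1,E_2,E_3,E_4)} of the cone decomposition, and set d = −α·K_{X_5}, d_i = α·E_i. Then d_1 ≤ d/5, d_2 ≤ d/5, and d_1 + d_2 + d_3 + d_4 ≤ 4d/5. -/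
/-- The exceptional class `eᵢ`. -/
def eB (i : Fin 4) : PicBl 4 := fun j => if j = i.succ then 1 else 0

/-- `h − eᵢ − eⱼ`, the class of the strict transform of the line through `pᵢ` and `pⱼ`. -/
def lB (i j : Fin 4) : PicBl 4 :=
  fun m => if m = 0 then 1 else if m = i.succ ∨ m = j.succ then -1 else 0

/-- `−K_{X₅} = 3h − e₁ − e₂ − e₃ − e₄`. -/
def negK5 : PicBl 4 := ![3, -1, -1, -1, -1]

/-- `ψ₅₆^*(−K_{X₆}) = 3h − e₂ − e₃ − e₄` (contraction of `e₁`). -/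
def negK6pull : PicBl 4 := ![3, 0, -1, -1, -1]

/-- `ψ₅₇^* H = h`. -/
def Hcl : PicBl 4 := ![1, 0, 0, 0, 0]

/-- `ψ₅₇^* F₁ = h − e₃`. -/
def F1cl : PicBl 4 := ![1, 0, 0, -1, 0]

/-- `ψ₅₇^* F₂ = h − e₄`. -/
def F2cl : PicBl 4 := ![1, 0, 0, 0, -1]

/-- Membership in the cone `𝒯` in the standard frame `(e₁, e₂, e₃, e₄)`. -/
def InStdCone (α : PicBl 4) : Prop :=
  ∃ b1 b2 a c1 c2 : ℕ, c1 ≤ c2 ∧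
    α = (b1 : ℤ) • negK5 + (b2 : ℤ) • negK6pull + (a : ℤ) • Hcl +
      (c1 : ℤ) • F1cl + (c2 : ℤ) • F2cl

/-- A marking: an automorphism of the Picard lattice preserving the intersection pairing
and the canonical class, i.e. a change of frame to another blow-up realisation
`X₅ → ℙ²` with exceptional divisors `σ(e₁), …, σ(e₄)`. -/
def IsMarking (σ : PicBl 4 ≃ₗ[ℤ] PicBl 4) : Prop :=
  (∀ x y, interB (σ x) (σ y) = interB x y) ∧ σ (KB 4) = KB 4

/-- `α` belongs to the cone `𝒯_{(σ(e₁), σ(e₂), σ(e₃), σ(e₄))}`. -/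
def InConeOf (σ : PicBl 4 ≃ₗ[ℤ] PicBl 4) (α : PicBl 4) : Prop := InStdCone (σ.symm α)

/-- A marking preserves degrees: `α · σ(x) = σ⁻¹(α) · x`. -/
theorem IsMarking.interB_apply {σ : PicBl 4 ≃ₗ[ℤ] PicBl 4} (hσ : IsMarking σ)
    (α x : PicBl 4) : interB α (σ x) = interB (σ.symm α) x := by
  rw [← hσ.1 (σ.symm α) x, σ.apply_symm_apply]

/-- A marking preserves the anticanonical degree. -/
theorem IsMarking.interB_neg_KB {σ : PicBl 4 ≃ₗ[ℤ] PicBl 4} (hσ : IsMarking σ)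
    (α : PicBl 4) : interB α (-KB 4) = interB (σ.symm α) (-KB 4) := by
  rw [← hσ.interB_apply, map_neg, hσ.2]

/-- The degree bounds in the standard frame. -/
theorem InStdCone.degree_bounds {β : PicBl 4} (hβ : InStdCone β) :
    5 * interB β (eB 0) ≤ interB β (-KB 4) ∧
    5 * interB β (eB 1) ≤ interB β (-KB 4) ∧
    5 * (interB β (eB 0) + interB β (eB 1) + interB β (eB 2) + interB β (eB 3)) ≤
      4 * interB β (-KB 4) := by
  obtain ⟨b1, b2, a, c1, c2, -, rfl⟩ := hβ
  simp [interB, eB, KB, negK5, negK6pull, Hcl, F1cl, F2cl, Fin.sum_univ_succ]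
  omega

/-- Let `α` be a nef class on a split quintic del Pezzo surface `X₅`
lying in a cone `𝒯_{(E₁,E₂,E₃,E₄)}` of the cone decomposition (for the frame
`Eᵢ = σ(eᵢ)` of a marking `σ`), and set `d = −α·K_{X₅}`, `dᵢ = α·Eᵢ`.  Then
`d₁ ≤ d/5`, `d₂ ≤ d/5` and `d₁ + d₂ + d₃ + d₄ ≤ 4d/5`. -/
theorem statement5 (α : PicBl 4) (hα : NefB α)
    (σ : PicBl 4 ≃ₗ[ℤ] PicBl 4) (hσ : IsMarking σ) (hcone : InConeOf σ α) :
    5 * interB α (σ (eB 0)) ≤ interB α (-KB 4) ∧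
    5 * interB α (σ (eB 1)) ≤ interB α (-KB 4) ∧
    5 * (interB α (σ (eB 0)) + interB α (σ (eB 1)) + interB α (σ (eB 2)) +
        interB α (σ (eB 3))) ≤ 4 * interB α (-KB 4) := by
  rw [hσ.interB_neg_KB]
  simp only [hσ.interB_apply]
  exact hcone.degree_bounds
end

section
/- Let n ≥ 1 be an integer and q > 1 a real number. Let F(𝐓) = Σ_{𝐝 ∈ ℕ^n} a_𝐝 𝐓^𝐝 be a power series with complex coefficients which converges absolutely on the closed polydisk of radius (r,…,r) for some r > 1/q, and define coefficients b_𝐝 by F(𝐓)/∏_{i=1}^n (1 − qT_i) = Σ_{𝐝 ∈ ℕ^n} b_𝐝 𝐓^𝐝. Then for every sufficiently small ε > 0 (so that q^{−1+ε} ≤ r) and all 𝐝 ∈ ℕ^n: | b_𝐝 − F(q^{−1},…,q^{−1})·q^{|𝐝|} | ≤ (q^{−ε}·‖F‖_{q^{−1+ε}} / (1 − q^{−ε})^n) · Σ_{i=1}^n q^{|𝐝| − ε d_i}, where |𝐝| = d_1 + … + d_n and ‖F‖_η = max over |T_1| = … = |T_n| = η of |F(𝐓)|. In particular, | b_𝐝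 q^{−|𝐝|} − F(q^{−1},…,q^{−1}) | = O_ε( q^{−ε·min_i d_i} ). -/
/-!
# Statement 19

Let `n ≥ 1` be an integer and `q > 1` a real number.  Let `F(𝐓) = Σ_{𝐝 ∈ ℕⁿ} a_𝐝 𝐓^𝐝` be a
power series with complex coefficients converging absolutely on the closed polydisk of
radius `(r, …, r)` for some `r > 1/q`, and let `b_𝐝` be the coefficients of
`F(𝐓)/∏ᵢ (1 − q Tᵢ)`, i.e. `b_𝐝 = Σ_{𝐞 ≤ 𝐝} a_𝐞 q^{|𝐝|−|𝐞|}`.  Then for every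
sufficiently small `ε > 0` (so that `q^{−1+ε} ≤ r`) and all `𝐝`:
`|b_𝐝 − F(q⁻¹,…,q⁻¹) q^{|𝐝|}| ≤ (q^{−ε} ‖F‖_{q^{−1+ε}} / (1 − q^{−ε})ⁿ) Σᵢ q^{|𝐝| − ε dᵢ}`,
where `‖F‖_η` is the sup of `|F(𝐓)|` over `|T₁| = ⋯ = |Tₙ| = η`.  In particular
`|b_𝐝 q^{−|𝐝|} − F(q⁻¹,…,q⁻¹)| = O_ε(q^{−ε minᵢ dᵢ})`.
-/

open MeasureTheory in
/-- Cauchy's estimate for the coefficients of an absolutely convergent multivariate power series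
on a torus. -/
theorem norm_coeff_mul_pow_le_of_forall_torus {ι : Type*} [Fintype ι] {a : (ι → ℕ) → ℂ}
    {η M : ℝ} (hη : 0 ≤ η) (ha : Summable fun e : ι → ℕ => ‖a e‖ * η ^ ∑ i, e i)
    (hM : ∀ T : ι → ℂ, (∀ i, ‖T i‖ = η) → ‖∑' e : ι → ℕ, a e * ∏ i, T i ^ e i‖ ≤ M)
    (e : ι → ℕ) : ‖a e‖ * η ^ ∑ i, e i ≤ M := by
  classical
  let m : (ι → ℕ) → C(UnitAddTorus ι, ℂ) := fun e => UnitAddTorus.mFourier fun i => (e i : ℤ)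
  let c : (ι → ℕ) → ℂ := fun e => a e * (η : ℂ) ^ ∑ i, e i
  have hc : ∀ e, ‖c e‖ = ‖a e‖ * η ^ ∑ i, e i := fun e => by
    simp [c, abs_of_nonneg hη]
  obtain ⟨g, hg⟩ : Summable fun e => c e • m e := by
    refine .of_norm (ha.congr fun e => ?_)
    rw [norm_smul, UnitAddTorus.mFourier_norm, mul_one, hc]
  have hgM : ∀ t, ‖g t‖ ≤ M := fun t => by
    have hgt := ((ContinuousMap.evalCLM ℂ t).hasSum hg).tsum_eq
    simp only [ContinuousMap.evalCLM_apply] at hgt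
    rw [← hgt]
    convert hM (fun i => (η : ℂ) * AddCircle.toCircle (t i)) (fun i => by
      rw [norm_mul, Circle.norm_coe, mul_one, Complex.norm_real, Real.norm_of_nonneg hη])
      using 4 with e
    simp only [c, m, UnitAddTorus.mFourier, ContinuousMap.smul_apply, ContinuousMap.coe_mk,
      fourier_apply, AddCircle.toCircle_zsmul, zpow_natCast, Circle.coe_pow, smul_eq_mul, mul_pow,
      Finset.prod_mul_distrib, Finset.prod_pow_eq_pow_sum, mul_assoc]
  let μ : Measure (UnitAddTorus ι) := Measure.pi fun _ => AddCircle.haarAddCircle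
  let L := ContinuousMap.toLp (E := ℂ) 2 μ ℂ
  have hv : Orthonormal ℂ fun e => L (m e) :=
    UnitAddTorus.orthonormal_mFourier.comp (fun (e : ι → ℕ) i => (e i : ℤ)) fun e e' h =>
      funext fun i => Int.ofNat_inj.mp (congrFun h i)
  have hinner : inner ℂ (L (m e)) (L g) = c e := by
    have h := (innerSL ℂ (L (m e))).hasSum (L.hasSum hg)
    refine h.unique ((hasSum_ite_eq e (c e)).congr_fun fun e' => ?_)
    rw [map_smul, map_smul, innerSL_apply_apply, smul_eq_mul, orthonormal_iff_ite.mp hv e e']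
    by_cases h : e = e'
    · simp [h]
    · simp [h, Ne.symm h]
  have hM0 : 0 ≤ M := (norm_nonneg _).trans (hgM 0)
  rw [← hc, ← hinner]
  refine (norm_inner_le_norm _ _).trans ?_
  rw [hv.1 e, one_mul]
  have := Lp.norm_le_of_ae_bound (f := L g) hM0 (by
    filter_upwards [ContinuousMap.coeFn_toLp (p := 2) (𝕜 := ℂ) μ g] with t ht
    rw [ht]
    exact hgM t)
  simpa [measureUnivNNReal] using this

/-- A product of convergent series with nonnegative terms, indexed by tuples. -/
theorem hasSum_prod_of_nonneg {α : Type*} {n : ℕ} {f : Fin n → α → ℝ} {s : Fin n → ℝ}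
    (hf : ∀ i k, 0 ≤ f i k) (hs : ∀ i, HasSum (f i) (s i)) :
    HasSum (fun d : Fin n → α => ∏ i, f i (d i)) (∏ i, s i) := by
  induction n with
  | zero => simp
  | succ n ih =>
    have htail := ih (fun i k => hf (Fin.succ i) k) fun i => hs i.succ
    have hnn : 0 ≤ fun d : Fin n → α => ∏ i : Fin n, f i.succ (d i) := fun d =>
      Finset.prod_nonneg fun i _ => hf i.succ (d i)
    have hsum := Summable.mul_of_nonneg (hs 0).summable htail.summable (hf 0) hnn
    have h := HasSum.mul (hs 0) htail hsum
    rw [Fin.prod_univ_succ, ← (Fin.consEquiv fun _ => α).hasSum_iff]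
    simpa [Function.comp_def, Fin.prod_univ_succ, Fin.consEquiv] using h

theorem hasSum_ite_lt_geometric {x : ℝ} (hx0 : 0 ≤ x) (hx1 : x < 1) (k : ℕ) :
    HasSum (fun m => if k < m then x ^ m else 0) (x ^ (k + 1) * (1 - x)⁻¹) := by
  rw [← hasSum_nat_add_iff' (k + 1), Finset.sum_eq_zero fun m hm =>
    if_neg (by have := Finset.mem_range.mp hm; omega), sub_zero]
  refine ((hasSum_geometric_of_lt_one hx0 hx1).mul_left (x ^ (k + 1))).congr_fun fun m => ?_
  rw [if_pos (by omega), pow_add, mul_comm]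

/-- The geometric series over the tuples whose `i`-th entry exceeds `k`. -/
theorem hasSum_ite_lt_geometric_pi {n : ℕ} {x : ℝ} (hx0 : 0 ≤ x) (hx1 : x < 1) (i : Fin n)
    (k : ℕ) :
    HasSum (fun e : Fin n → ℕ => if k < e i then x ^ ∑ j, e j else 0)
      (x ^ (k + 1) * ((1 - x)⁻¹) ^ n) := by
  have h := hasSum_prod_of_nonneg
    (f := fun j m => if j = i then (if k < m then x ^ m else 0) else x ^ m)
    (s := fun j => (if j = i then x ^ (k + 1) else 1) * (1 - x)⁻¹)
    (fun j m => by positivity) fun j => by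
      by_cases hj : j = i
      · simpa [hj] using hasSum_ite_lt_geometric hx0 hx1 k
      · simpa [hj] using hasSum_geometric_of_lt_one hx0 hx1
  convert h using 1
  · ext e
    split_ifs with hk
    · rw [← Finset.prod_pow_eq_pow_sum]
      refine Finset.prod_congr rfl fun j _ => ?_
      by_cases hj : j = i
      · subst hj; simp [hk]
      · simp [hj]
    · exact (Finset.prod_eq_zero (Finset.mem_univ i) (by simp [hk])).symm
  · rw [Finset.prod_mul_distrib]
    simp

/-- The truncation error, at a box, of a series dominated by a multivariate geometric series. -/
theorem norm_sum_Iic_sub_tsum_le {n : ℕ} {u : (Fin n → ℕ) → ℂ} {x M : ℝ} (hx0 : 0 ≤ x)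
    (hx1 : x < 1) (hu : Summable u) (huM : ∀ e, ‖u e‖ ≤ M * x ^ ∑ i, e i) (d : Fin n → ℕ) :
    ‖∑ e ∈ Finset.Iic d, u e - ∑' e, u e‖ ≤
      M * ∑ i, x ^ (d i + 1) * ((1 - x)⁻¹) ^ n := by
  classical
  have hM : 0 ≤ M := by simpa using (norm_nonneg _).trans (huM 0)
  have hfin : HasSum (fun e => if e ∈ Finset.Iic d then u e else 0)
      (∑ e ∈ Finset.Iic d, u e) := by
    rw [← Finset.sum_congr rfl fun e he => if_pos he]
    exact hasSum_sum_of_ne_finset_zero fun e he => if_neg he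
  rw [← (hfin.sub hu.hasSum).tsum_eq]
  refine tsum_of_norm_bounded
    ((hasSum_sum fun i _ => hasSum_ite_lt_geometric_pi hx0 hx1 i (d i)).mul_left M) fun e => ?_
  have hnn : ∀ i ∈ Finset.univ, 0 ≤ (if d i < e i then x ^ ∑ j, e j else 0) :=
    fun i _ => by positivity
  by_cases he : e ≤ d
  · simpa [he] using mul_nonneg hM (Finset.sum_nonneg hnn)
  · obtain ⟨i, hi⟩ := not_forall.mp he
    rw [if_neg (by simpa using he), zero_sub, norm_neg]
    refine (huM e).trans (mul_le_mul_of_nonneg_left ?_ hM)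
    refine le_trans ?_ (Finset.single_le_sum hnn (Finset.mem_univ i))
    rw [if_pos (not_le.mp hi)]

theorem statement19
    (n : ℕ) (hn : 1 ≤ n) (q : ℝ) (hq : 1 < q)
    (a : (Fin n → ℕ) → ℂ) (r : ℝ) (hr : 1 / q < r)
    -- absolute convergence of `F` on the closed polydisk of radius `(r, …, r)`
    (habs : Summable fun d : Fin n → ℕ => ‖a d‖ * r ^ (∑ i, d i))
    -- the coefficients of `F(𝐓) / ∏ i (1 - q * T i)`
    (b : (Fin n → ℕ) → ℂ)
    (hb : ∀ d : Fin n → ℕ,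
      b d = ∑ e ∈ Finset.Iic d, a e * (q : ℂ) ^ ((∑ i, d i) - (∑ i, e i))) :
    ∀ ε : ℝ, 0 < ε → q ^ (-1 + ε : ℝ) ≤ r →
      (∀ d : Fin n → ℕ,
        ‖b d - (∑' e : Fin n → ℕ, a e * ((q : ℂ)⁻¹) ^ (∑ i, e i)) * (q : ℂ) ^ (∑ i, d i)‖ ≤
          q ^ (-ε : ℝ) *
              sSup {x : ℝ | ∃ T : Fin n → ℂ, (∀ i, ‖T i‖ = q ^ (-1 + ε : ℝ)) ∧
                x = ‖∑' e : Fin n → ℕ, a e * ∏ i, T i ^ e i‖} /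
              (1 - q ^ (-ε : ℝ)) ^ n *
            ∑ i : Fin n, q ^ ((∑ j, d j : ℝ) - ε * d i)) ∧
      (∃ C : ℝ, 0 < C ∧ ∀ d : Fin n → ℕ,
        ‖b d * ((q : ℂ)⁻¹) ^ (∑ i, d i) - ∑' e : Fin n → ℕ, a e * ((q : ℂ)⁻¹) ^ (∑ i, e i)‖ ≤
          C * q ^ (-ε * (Finset.univ.inf' ⟨⟨0, hn⟩, Finset.mem_univ _⟩ d : ℕ) : ℝ)) := by
  intro ε hε hηr
  have hq0 : 0 < q := by linarith
  have hqc : (q : ℂ) ≠ 0 := by exact_mod_cast hq0.ne'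
  set η : ℝ := q ^ (-1 + ε : ℝ) with hη
  set x : ℝ := q ^ (-ε : ℝ) with hx
  have hη0 : 0 < η := Real.rpow_pos_of_pos hq0 _
  have hx0 : 0 < x := Real.rpow_pos_of_pos hq0 _
  have hx1 : x < 1 := Real.rpow_lt_one_of_one_lt_of_neg hq (neg_lt_zero.mpr hε)
  have hηx : η * x = q⁻¹ := by
    rw [hη, hx, ← Real.rpow_add hq0, ← Real.rpow_neg_one]
    ring_nf
  have hsum : Summable fun e : Fin n → ℕ => ‖a e‖ * η ^ ∑ i, e i :=
    habs.of_nonneg_of_le (fun e => by positivity) fun e => by gcongr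
  set S : Set ℝ := {y : ℝ | ∃ T : Fin n → ℂ, (∀ i, ‖T i‖ = η) ∧
    y = ‖∑' e : Fin n → ℕ, a e * ∏ i, T i ^ e i‖}
  have hbdd : BddAbove S := by
    refine ⟨∑' e : Fin n → ℕ, ‖a e‖ * η ^ ∑ i, e i, ?_⟩
    rintro _ ⟨T, hT, rfl⟩
    refine tsum_of_norm_bounded hsum.hasSum fun e => ?_
    simp [hT, Finset.prod_pow_eq_pow_sum]
  set M : ℝ := sSup S
  have hcoeff := norm_coeff_mul_pow_le_of_forall_torus hη0.le hsum fun T hT =>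
    le_csSup hbdd ⟨T, hT, rfl⟩
  have hM0 : 0 ≤ M := le_trans (by positivity) (hcoeff 0)
  set u : (Fin n → ℕ) → ℂ := fun e => a e * ((q : ℂ)⁻¹) ^ ∑ i, e i with hu
  have hnorm : ∀ e, ‖u e‖ = ‖a e‖ * η ^ (∑ i, e i) * x ^ ∑ i, e i := fun e => by
    rw [mul_assoc, ← mul_pow, hηx]
    simp [hu, abs_of_pos hq0]
  have huM : ∀ e, ‖u e‖ ≤ M * x ^ ∑ i, e i := fun e => by
    rw [hnorm]
    exact mul_le_mul_of_nonneg_right (hcoeff e) (by positivity)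
  have husum : Summable u := .of_norm <| hsum.of_nonneg_of_le (fun e => norm_nonneg _) fun e => by
    rw [hnorm]
    exact mul_le_of_le_one_right (by positivity) (pow_le_one₀ hx0.le hx1.le)
  have hbu : ∀ d, b d * ((q : ℂ)⁻¹) ^ (∑ i, d i) = ∑ e ∈ Finset.Iic d, u e := fun d => by
    rw [hb, Finset.sum_mul]
    refine Finset.sum_congr rfl fun e he => ?_
    have hle : ∑ i, e i ≤ ∑ i, d i := Finset.sum_le_sum fun i _ => Finset.mem_Iic.mp he i
    rw [pow_sub₀ _ hqc hle, hu]
    simp only [inv_pow]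
    field_simp
  have hmain : ∀ d, ‖b d * ((q : ℂ)⁻¹) ^ (∑ i, d i) - ∑' e, u e‖ ≤
      M * ∑ i, x ^ (d i + 1) * ((1 - x)⁻¹) ^ n := fun d => by
    rw [hbu]
    exact norm_sum_Iic_sub_tsum_le hx0.le hx1 husum huM d
  have hxpow : ∀ k : ℕ, x ^ k = q ^ (-ε * k : ℝ) := fun k => by
    rw [hx, Real.rpow_mul hq0.le, Real.rpow_natCast]
  refine ⟨fun d => ?_, ?_⟩
  · have hfac : b d - (∑' e, u e) * (q : ℂ) ^ (∑ i, d i) =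
        (b d * ((q : ℂ)⁻¹) ^ (∑ i, d i) - ∑' e, u e) * (q : ℂ) ^ (∑ i, d i) := by
      rw [sub_mul, mul_assoc, ← mul_pow, inv_mul_cancel₀ hqc, one_pow, mul_one]
    rw [hfac, norm_mul, norm_pow, Complex.norm_real, Real.norm_of_nonneg hq0.le]
    refine (mul_le_mul_of_nonneg_right (hmain d) (by positivity)).trans (le_of_eq ?_)
    rw [Finset.mul_sum, Finset.mul_sum, Finset.sum_mul]
    refine Finset.sum_congr rfl fun i _ => ?_
    have hpow : q ^ ((∑ j, d j : ℝ) - ε * d i) = q ^ (∑ j, d j) * x ^ d i := by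
      rw [hxpow, ← Real.rpow_natCast, ← Real.rpow_add hq0]
      push_cast
      ring_nf
    rw [hpow, pow_succ, inv_pow]
    ring
  · have hy : 0 < (1 - x)⁻¹ := inv_pos.mpr (sub_pos.mpr hx1)
    refine ⟨M * (n * ((1 - x)⁻¹) ^ n) + 1, by positivity, fun d => (hmain d).trans ?_⟩
    rw [← hxpow]
    set k := Finset.univ.inf' ⟨⟨0, hn⟩, Finset.mem_univ _⟩ d
    have hterm : ∑ i, x ^ (d i + 1) * ((1 - x)⁻¹) ^ n ≤ n * (x ^ k * ((1 - x)⁻¹) ^ n) := by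
      refine (Finset.sum_le_card_nsmul _ _ (x ^ k * ((1 - x)⁻¹) ^ n) fun i _ => ?_).trans (by simp)
      refine mul_le_mul_of_nonneg_right (pow_le_pow_of_le_one hx0.le hx1.le ?_) (by positivity)
      exact (Finset.inf'_le d (Finset.mem_univ i)).trans (Nat.le_succ _)
    have hxk : 0 < x ^ k := by positivity
    calc _ ≤ M * (n * (x ^ k * ((1 - x)⁻¹) ^ n)) := mul_le_mul_of_nonneg_left hterm hM0
      _ ≤ _ := by linarith
end
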